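/- (Column exchange move, k = d = 2.) Fix ℓ ≥ 2 and y ∈ ℤ². Let M be the set of configurations η : ℤ² → {0,1} such that every site of the column y + {0}×[ℓ] is empty and the column y + {1}×[ℓ] contains at least one empty site. There exists a T-step move M with domain determined by M whose transitions are contained in y + {0,1}×[ℓ], such that for every η the final configuration M_T η agrees with η outside y + {0,1}×[ℓ] and has the restrictions of η to the columns y + {0}×[ℓ] and y + {1}×[ℓ] exchanged. Moreover, Loss(M) ≤ C log₂ ℓ and T ≤ C ℓ for a universal constant C. -/

import Mathlib

open MeasureTheory ENNReal

noncomputable section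

namespace KA

open scoped Classical

/-- Sites of the lattice `ℤ^d`. -/
abbrev Site (d : ℕ) := Fin d → ℤ

/-- A configuration: `true` = occupied, `false` = empty. -/
abbrev Config (d : ℕ) := Site d → Bool

variable {d : ℕ}

def origin : Site d := fun _ => 0

def eVec (d : ℕ) (i : Fin d) : Site d := fun j => if j = i then 1 else 0

/-- Nearest neighbours in `ℤ^d`. -/
def adj (x y : Site d) : Prop := (∑ i, |x i - y i|) = 1

/-- The set of (at most `2d`) nearest neighbours of a site. -/
def neighbors (x : Site d) : Finset (Site d) :=
  Finset.image (fun p : Fin d × Bool =>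
    Function.update x p.1 (x p.1 + if p.2 then 1 else -1)) Finset.univ

/-- The Kob-Andersen kinetic constraint `c_{xy}` for parameter `k`:
`x` has at least `k-1` empty neighbours other than `y`, and vice versa. -/
def constraint (k : ℕ) (η : Config d) (x y : Site d) : Prop :=
  k - 1 ≤ ((neighbors x).filter fun z => z ≠ y ∧ η z = false).card ∧
  k - 1 ≤ ((neighbors y).filter fun z => z ≠ x ∧ η z = false).card

/-- `c_{xy}(η)` as a `{0,1}`-valued quantity. -/
def cval (k : ℕ) (η : Config d) (x y : Site d) : ℝ≥0∞ :=
  if constraint k η x y then 1 else 0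

/-- `η^{xy}` : the configuration with the values at `x` and `y` exchanged. -/
def swap (η : Config d) (x y : Site d) : Config d :=
  fun z => if z = x then η y else if z = y then η x else η z

/-- `(τ_y η)(z) = η (z - y)`. -/
def shift (y : Site d) (η : Config d) : Config d := fun z => η (z - y)

/-- A local function depends on finitely many coordinates. -/
def IsLocal (f : Config d → ℝ) : Prop :=
  ∃ S : Finset (Site d), ∀ η η' : Config d, (∀ x ∈ S, η x = η' x) → f η = f η'

def dotZ (u : Fin d → ℝ) (y : Site d) : ℝ := ∑ i, u i * (y i : ℝ)

/-- The environment part `Σ_{x ≠ 0} Σ_{y ∼ x} c_{xy} (f(η^{xy}) - f(η))²`. -/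
def envTerm (k : ℕ) (f : Config d → ℝ) (η : Config d) : ℝ≥0∞ :=
  ∑' p : Site d × Site d,
    if p.1 ≠ origin ∧ adj p.1 p.2 then
      cval k η p.1 p.2 * ENNReal.ofReal ((f (swap η p.1 p.2) - f η) ^ 2)
    else 0

/-- The tagged-particle part `Σ_{y ∼ 0} c_{0y} (u·y + f(τ_y η^{0y}) - f(η))²`. -/
def tagTerm (k : ℕ) (u : Fin d → ℝ) (f : Config d → ℝ) (η : Config d) : ℝ≥0∞ :=
  ∑' y : Site d,
    if adj origin y then
      cval k η origin y *
        ENNReal.ofReal ((dotZ u y + f (shift y (swap η origin y)) - f η) ^ 2)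
    else 0

/-- The variational (Dirichlet) functional `E_u(f)` integrated against `μ₀`. -/
def energy (k : ℕ) (u : Fin d → ℝ) (μ0 : Measure (Config d)) (f : Config d → ℝ) : ℝ≥0∞ :=
  ∫⁻ η, envTerm k f η + tagTerm k u f η ∂μ0

/-- `μ` is the Bernoulli product measure where each site is independently
occupied with probability `1 - q`. -/
def IsBernoulliProduct (q : ℝ) (μ : Measure (Config d)) : Prop :=
  IsProbabilityMeasure μ ∧
  ∀ (S : Finset (Site d)) (ζ : Site d → Bool),
    μ {η | ∀ x ∈ S, η x = ζ x} = ∏ x ∈ S, ENNReal.ofReal (if ζ x then 1 - q else q)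

/-- `μ₀ = μ(· | η(0) = 1)`. -/
def condOcc (μ : Measure (Config d)) : Measure (Config d) :=
  ProbabilityTheory.cond μ {η | η origin = true}

/-- The first standard basis vector of `ℝ^d`. -/
def e1R (d : ℕ) : Fin d → ℝ := fun i => if (i : ℕ) = 0 then 1 else 0

def basisR (d : ℕ) (i : Fin d) : Fin d → ℝ := fun j => if j = i then 1 else 0

/-- The quadratic form `u ↦ inf over local f of E_u(f)`. -/
def Qform (k : ℕ) (μ : Measure (Config d)) (u : Fin d → ℝ) : ℝ≥0∞ :=
  ⨅ f : {f : Config d → ℝ // IsLocal f}, energy k u (condOcc μ) f.1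

/-- The self-diffusion coefficient `D(q) = inf_f E_{e₁}(f)`. -/
def diffCoeff (k : ℕ) (μ : Measure (Config d)) : ℝ≥0∞ := Qform k μ (e1R d)

/-- `expIter n` is the `n`-fold iterated exponential. -/
def expIter : ℕ → ℝ → ℝ
  | 0, x => x
  | n + 1, x => Real.exp (expIter n x)

/-! ### Frameability, goodness, block-connectedness -/

/-- Fill every site outside `V` with a particle. -/
def fillOutside (V : Set (Site d)) (η : Config d) : Config d :=
  fun z => if z ∈ V then η z else true

/-- A single legal KA-`k`f transition inside `V`. -/
def KAStep (k : ℕ) (V : Set (Site d)) (η η' : Config d) : Prop :=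
  ∃ x y, adj x y ∧ x ∈ V ∧ y ∈ V ∧ η x ≠ η y ∧ constraint k η x y ∧ η' = swap η x y

/-- A generalized box with minimal corner `a`, spanning the directions in `E`,
with side length `m` (coordinates outside `E` are frozen at `a`). -/
def genBox (a : Site d) (E : Finset (Fin d)) (m : ℕ) : Set (Site d) :=
  {x | ∀ i, (i ∈ E → a i ≤ x i ∧ x i < a i + m) ∧ (i ∉ E → x i = a i)}

/-- The `k'`-th frame of the generalized box: the union of all of its
`(k'-1)`-dimensional slices passing through the minimal corner. -/
def genFrame (k' : ℕ) (a : Site d) (E : Finset (Fin d)) (m : ℕ) : Set (Site d) :=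
  {x | x ∈ genBox a E m ∧ (E.filter fun i => x i ≠ a i).card ≤ k' - 1}

/-- The generalized box is frameable for `η` : `η` (with the outside filled by
particles) is connected by legal KA-`k'`f transitions inside the box to a
configuration whose `k'`-th frame is empty. -/
def Frameable (k' : ℕ) (a : Site d) (E : Finset (Fin d)) (m : ℕ) (η : Config d) : Prop :=
  ∃ η', Relation.ReflTransGen (KAStep k' (genBox a E m)) (fillOutside (genBox a E m) η) η' ∧
    ∀ x ∈ genFrame k' a E m, η' x = false

def one (d : ℕ) : Site d := fun _ => 1

/-- minimal corner of the box `b + [m]^d`. -/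
def corner (b : Site d) : Site d := fun i => b i + 1

/-- All codimension-one slices of the generalized box are `(k'-1)`-frameable,
for every configuration differing from `η` in at most one site. -/
def SlicesOK (k' : ℕ) (a : Site d) (E : Finset (Fin d)) (m : ℕ) (η : Config d) : Prop :=
  ∀ η' : Config d, {x | η' x ≠ η x}.Subsingleton →
    ∀ i ∈ E, ∀ t : ℕ, t < m →
      Frameable (k' - 1) (Function.update a i (a i + t)) (E.erase i) m η'

/-- A good box: all codimension-one slices frameable (robustly to one spin flip),
with one extra empty site in addition to the ones required. -/
def GoodBox (k' : ℕ) (a : Site d) (E : Finset (Fin d)) (m : ℕ) (η : Config d) : Prop :=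
  SlicesOK k' a E m η ∧
  ∃ x₀ ∈ genBox a E m, η x₀ = false ∧ SlicesOK k' a E m (Function.update η x₀ true)

/-- The length scale `ℓ = ℓ(q)`. -/
def lscale (d k : ℕ) (c q : ℝ) : ℕ :=
  if k = 2 then ⌈c * Real.log (1 / q) * q ^ (-(1 : ℝ) / ((d : ℝ) - 1))⌉₊
  else ⌈c * expIter (k - 2) (q ^ (-(1 : ℝ) / ((d : ℝ) - (k : ℝ) + 1)))⌉₊

/-- The length scale `L = q^{-cℓ}`. -/
def Lscale (q c : ℝ) (ℓ : ℕ) : ℕ := ⌈q ^ (-(c * (ℓ : ℝ)))⌉₊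

/-- One step between adjacent boxes: the base point moves by `±ℓ e_i`. -/
def pathStep (ℓ : ℕ) (b b' : Site d) : Prop :=
  ∃ i : Fin d, ∃ s : Bool,
    b' = fun j => b j + if j = i then (if s then (ℓ : ℤ) else -(ℓ : ℤ)) else 0

/-- A `(d,k)`-super-good path of boxes of side `ℓ` inside the block `v + [L]^d`,
joining `v + [ℓ]^d` to `v + (L-ℓ)e_α + [ℓ]^d`, of length at most `3L`:
all boxes good and at least one frameable. -/
def SuperGoodPath (k ℓ L : ℕ) (v : Site d) (α : Fin d) (η : Config d) : Prop :=
  ∃ n : ℕ, n ≤ 3 * L ∧ ∃ b : ℕ → Site d,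
    b 0 = v ∧
    (b n = fun j => v j + if j = α then (L : ℤ) - (ℓ : ℤ) else 0) ∧
    (∀ m < n, pathStep ℓ (b m) (b (m + 1))) ∧
    (∀ m ≤ n, genBox (corner (b m)) Finset.univ ℓ ⊆ genBox (corner v) Finset.univ L) ∧
    (∀ m ≤ n, GoodBox k (corner (b m)) Finset.univ ℓ η) ∧
    (∃ m ≤ n, Frameable k (corner (b m)) Finset.univ ℓ η)

/-- minimal corner of the external face of the box `genBox a univ m` in
direction `j`, on the positive (`s = true`) or negative side. -/
def faceBase (a : Site d) (m : ℕ) (j : Fin d) (s : Bool) : Site d :=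
  Function.update a j (if s then a j + m else a j - 1)

/-- The face `F` is adjacent to the vertex `v`. -/
def FaceNear (v : Site d) (F : Set (Site d)) : Prop := ∃ x ∈ F, ∀ i, |x i - v i| ≤ 1

/-- All `(d-1)`-dimensional external faces of the box `genBox a univ m` that are
adjacent to the vertex `v` are `(d-1, k-1)`-good. -/
def GoodFacesAt (k : ℕ) (a : Site d) (m : ℕ) (v : Site d) (η : Config d) : Prop :=
  ∀ (j : Fin d) (s : Bool),
    FaceNear v (genBox (faceBase a m j s) (Finset.univ.erase j) m) →
    GoodBox (k - 1) (faceBase a m j s) (Finset.univ.erase j) m η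

/-- The coarse vertices `v` and `v + (L+1)e_α` are `(d,k)`-block-connected. -/
def BlockConnected (k ℓ L : ℕ) (v : Site d) (α : Fin d) (η : Config d) : Prop :=
  SuperGoodPath k ℓ L v α η ∧
  GoodFacesAt k (corner v) ℓ v η ∧
  GoodFacesAt k (corner (fun j => v j + if j = α then (L : ℤ) - (ℓ : ℤ) else 0)) (ℓ + 1)
    (fun j => v j + if j = α then (L : ℤ) + 1 else 0) η

/-! ### `T`-step moves -/

/-- A `T`-step move with domain determined by the set of configurations `M`,
whose transitions are legal KA-`k`f transitions contained in `V`,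
keeping track of the position of a marked particle. -/
structure TStepMove (d k : ℕ) (M : Set (Config d)) (V : Set (Site d)) (T : ℕ) where
  conf : Config d → ℕ → Config d
  pos : Config d → Site d → ℕ → Site d
  conf_zero : ∀ η ∈ M, conf η 0 = η
  pos_zero : ∀ η ∈ M, ∀ z : Site d, η z = true → pos η z 0 = z
  step : ∀ η ∈ M, ∀ z : Site d, η z = true → ∀ t < T,
    (conf η (t + 1) = conf η t ∧ pos η z (t + 1) = pos η z t) ∨
    ∃ x y, adj x y ∧ x ∈ V ∧ y ∈ V ∧ conf η t x = true ∧ conf η t y = false ∧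
      constraint k (conf η t) x y ∧ conf η (t + 1) = swap (conf η t) x y ∧
      pos η z (t + 1) = if pos η z t = x then y else pos η z t

/-- `Loss(M) ≤ K` : at every step, at most `2^K` configurations of the domain
have a common image. -/
def LossBoundedBy {d k : ℕ} {M : Set (Config d)} {V : Set (Site d)} {T : ℕ}
    (mv : TStepMove d k M V T) (K : ℝ) : Prop :=
  ∀ t < T, ∀ η' ∈ M, ∃ S : Finset (Config d),
    {η ∈ M | mv.conf η t = mv.conf η' t ∧ mv.conf η (t + 1) = mv.conf η' (t + 1)} ⊆ ↑S ∧
    (S.card : ℝ) ≤ (2 : ℝ) ^ K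

/-! ### Bond configurations on the coarse lattice -/

/-- A bond configuration on the coarse lattice: the edge `(i, α)` joins the
coarse vertices of index `i` and `i + e_α`. -/
abbrev BondConfig (d : ℕ) := (Site d × Fin d) → Bool

def IsLocalBond (g : BondConfig d → ℝ) : Prop :=
  ∃ S : Finset (Site d × Fin d), ∀ ω ω' : BondConfig d, (∀ e ∈ S, ω e = ω' e) → g ω = g ω'

/-- Translation of a bond configuration by a coarse index vector. -/
def bondShift (v : Site d) (ω : BondConfig d) : BondConfig d := fun e => (ω (e.1 - v, e.2))

/-- Two coarse indices joined by an open bond. -/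
def bondRel (ω : BondConfig d) (i j : Site d) : Prop :=
  (∃ α, j = i + eVec d α ∧ ω (i, α) = true) ∨ (∃ α, i = j + eVec d α ∧ ω (j, α) = true)

/-- The event `{0 ↔ ∞}`: the origin lies in an infinite open cluster. -/
def InfiniteCluster : Set (BondConfig d) :=
  {ω | {j : Site d | Relation.ReflTransGen (bondRel ω) origin j}.Infinite}

/-- The coarse index of the neighbour `± e_α` of the coarse origin. -/
def coarseIdx (d : ℕ) (α : Fin d) (s : Bool) : Site d :=
  if s then eVec d α else -(eVec d α)

/-- The actual lattice vector `±(L+1) e_α` of a coarse neighbour of the origin. -/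
def coarseVecZ (d L : ℕ) (α : Fin d) (s : Bool) : Site d :=
  fun j => ((L : ℤ) + 1) * coarseIdx d α s j

/-- Indicator of the bond between the coarse origin and its neighbour `± e_α`. -/
def edgeInd (ω : BondConfig d) (α : Fin d) (s : Bool) : ℝ≥0∞ :=
  if (if s then ω (origin, α) else ω (-(eVec d α), α)) = true then 1 else 0

/-- The auxiliary quadratic form `u ↦ u ⬝ D_aux u`. -/
def QauxForm (d L : ℕ) (μstar : Measure (BondConfig d)) (u : Fin d → ℝ) : ℝ≥0∞ :=
  ⨅ g : {g : BondConfig d → ℝ // IsLocalBond g},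
    ∑ α : Fin d, ∑ s : Bool,
      ∫⁻ ω, edgeInd ω α s *
        ENNReal.ofReal (((if s then (1 : ℝ) else -1) * ((L : ℝ) + 1) * u α +
          g.1 (bondShift (coarseIdx d α s) ω) - g.1 ω) ^ 2) ∂μstar

/-- Indicator (on microscopic configurations) that the coarse origin and its
neighbour `± e_α` are block-connected, for an abstract notion `BC`. -/
def microEdgeInd (BC : Site d → Fin d → Config d → Bool) (α : Fin d) (s : Bool)
    (η : Config d) : ℝ≥0∞ :=
  if (if s then BC origin α η else BC (-(eVec d α)) α η) = true then 1 else 0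

/-- The microscopic comparison form
`u ↦ inf_f Σ_{i ∼ 0} μ₀[ η̄_{0i} (u·i + f(τ_i η^{0,i}) - f(η))² ]`. -/
def microForm (d k L : ℕ) (BC : Site d → Fin d → Config d → Bool)
    (μ0 : Measure (Config d)) (u : Fin d → ℝ) : ℝ≥0∞ :=
  ⨅ f : {f : Config d → ℝ // IsLocal f},
    ∑ α : Fin d, ∑ s : Bool,
      ∫⁻ η, microEdgeInd BC α s η *
        ENNReal.ofReal (((if s then (1 : ℝ) else -1) * ((L : ℝ) + 1) * u α +
          f.1 (shift (coarseVecZ d L α s) (swap η origin (coarseVecZ d L α s))) - f.1 η) ^ 2)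
        ∂μ0

/-! ### d = 2 geometry -/

/-- The column `y + {c} × [ℓ]` in `ℤ²`. -/
def col2 (y : Site 2) (c : ℤ) (ℓ : ℕ) : Set (Site 2) :=
  {x | x 0 = y 0 + c ∧ y 1 + 1 ≤ x 1 ∧ x 1 ≤ y 1 + ℓ}

/-- The box `b + [ℓ]²`. -/
def box2 (b : Site 2) (ℓ : ℕ) : Set (Site 2) := genBox (corner b) Finset.univ ℓ

/-- `S` contains at least two empty sites. -/
def TwoEmptyIn (S : Set (Site 2)) (η : Config 2) : Prop :=
  ∃ a ∈ S, ∃ b ∈ S, a ≠ b ∧ η a = false ∧ η b = false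

/-- Every row and every column of the box `b + [ℓ]²` contains at least two
empty sites. -/
def RowsColsOK (b : Site 2) (ℓ : ℕ) (η : Config 2) : Prop :=
  (∀ t : ℕ, 1 ≤ t → t ≤ ℓ → TwoEmptyIn {z | z ∈ box2 b ℓ ∧ z 1 = b 1 + t} η) ∧
  (∀ t : ℕ, 1 ≤ t → t ≤ ℓ → TwoEmptyIn {z | z ∈ box2 b ℓ ∧ z 0 = b 0 + t} η)

/-- The box `b + [ℓ]²` is `(2,2)`-good: two empty sites in every row and
column, plus one additional empty site. -/
def Good22 (b : Site 2) (ℓ : ℕ) (η : Config 2) : Prop :=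
  RowsColsOK b ℓ η ∧
  ∃ w ∈ box2 b ℓ, η w = false ∧ RowsColsOK b ℓ (Function.update η w true)

/-! ### Bootstrap percolation -/

/-- The box `[-ℓ, ℓ]^d`. -/
def bigBox (d ℓ : ℕ) : Set (Site d) := {x | ∀ i, |x i| ≤ (ℓ : ℤ)}

/-- One step of `k`-neighbour bootstrap percolation on `[-ℓ,ℓ]^d` (sites
outside the box are left unchanged). -/
def BPstep (k ℓ : ℕ) (η : Config d) : Config d := fun x =>
  if x ∈ bigBox d ℓ then
    (if η x = true ∧
        ((neighbors x).filter fun z => z ∈ bigBox d ℓ ∧ η z = false).card < k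
      then true else false)
  else η x

/-- The limiting configuration of bootstrap percolation. -/
def BPinf (k ℓ : ℕ) (η : Config d) : Config d := fun x =>
  if ∀ t : ℕ, (BPstep k ℓ)^[t] η x = true then true else false

/-- One step along the bootstrap percolation cluster. -/
def bpRel (k ℓ : ℕ) (η : Config d) (a b : Site d) : Prop :=
  adj a b ∧ b ∈ bigBox d ℓ ∧ BPinf k ℓ η b = false

/-- The bootstrap percolation cluster of the origin. -/
def bpCluster (k ℓ : ℕ) (η : Config d) : Set (Site d) :=
  {x | Relation.ReflTransGen (bpRel k ℓ η) origin x}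

def coord0 (x : Site d) : ℤ := if h : 0 < d then x ⟨0, h⟩ else 0

/-- The first coordinate of the rightmost site of the bootstrap percolation
cluster of the origin. -/
def bpRightmost (k ℓ : ℕ) (η : Config d) : ℝ :=
  sSup ((fun x : Site d => (coord0 x : ℝ)) '' bpCluster k ℓ η)

/-- The test function `f`, computed on the restriction to `[-ℓ,ℓ]^d`. -/
def fTest (d k ℓ : ℕ) (η : Config d) : ℝ :=
  bpRightmost k ℓ (fillOutside (bigBox d ℓ) η)

/-- The event `B` : the bootstrap percolation cluster of the origin contains a
site of `ℓ^∞`-norm at least `ℓ - 1`. -/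
def Bevent (k ℓ : ℕ) (η : Config d) : Prop :=
  ∃ x ∈ bpCluster k ℓ η, ∃ i, (ℓ : ℤ) - 1 ≤ |x i|

/-! ### Helper material for the column exchange move -/

/-- The site with coordinates `(a, b)`. -/
def mk2 (a b : ℤ) : Site 2 := ![a, b]

@[simp] theorem mk2_zero (a b : ℤ) : mk2 a b 0 = a := rfl

@[simp] theorem mk2_one (a b : ℤ) : mk2 a b 1 = b := rfl

theorem site_eq_iff (x z : Site 2) : x = z ↔ x 0 = z 0 ∧ x 1 = z 1 := by
  constructor
  · rintro rfl; exact ⟨rfl, rfl⟩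
  · rintro ⟨h0, h1⟩
    funext i
    fin_cases i
    · exact h0
    · exact h1

theorem adj_iff (x z : Site 2) : adj x z ↔ |x 0 - z 0| + |x 1 - z 1| = 1 := by
  simp [adj, Fin.sum_univ_two]

theorem adj_symm' {x z : Site 2} (h : adj x z) : adj z x := by
  rw [adj_iff] at *
  rw [abs_sub_comm (z 0), abs_sub_comm (z 1)]; exact h

theorem mem_neighbors_of_adj {x z : Site 2} (h : adj x z) : z ∈ neighbors x := by
  rw [adj_iff] at h
  have key : (z 0 = x 0 + 1 ∧ z 1 = x 1) ∨ (z 0 = x 0 - 1 ∧ z 1 = x 1) ∨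
      (z 0 = x 0 ∧ z 1 = x 1 + 1) ∨ (z 0 = x 0 ∧ z 1 = x 1 - 1) := by
    have h0 := abs_nonneg (x 0 - z 0)
    have h1 := abs_nonneg (x 1 - z 1)
    rcases abs_cases (x 0 - z 0) with h2 | h2 <;> rcases abs_cases (x 1 - z 1) with h3 | h3 <;>
      omega
  simp only [neighbors, Finset.mem_image, Finset.mem_univ, true_and]
  rcases key with h | h | h | h
  · exact ⟨(0, true), by rw [site_eq_iff]; simp [h.1, h.2]⟩
  · exact ⟨(0, false), by rw [site_eq_iff]; simp [h.1, h.2]; ring⟩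
  · exact ⟨(1, true), by rw [site_eq_iff]; simp [h.1, h.2]⟩
  · exact ⟨(1, false), by rw [site_eq_iff]; simp [h.1, h.2]; ring⟩

theorem constraint_of {η : Config 2} {x z : Site 2} (a b : Site 2)
    (ha : adj x a) (haz : a ≠ z) (hηa : η a = false)
    (hb : adj z b) (hbx : b ≠ x) (hηb : η b = false) : constraint 2 η x z := by
  constructor
  · exact Finset.card_pos.2 ⟨a, Finset.mem_filter.2 ⟨mem_neighbors_of_adj ha, haz, hηa⟩⟩
  · exact Finset.card_pos.2 ⟨b, Finset.mem_filter.2 ⟨mem_neighbors_of_adj hb, hbx, hηb⟩⟩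

theorem swap_swap (η : Config 2) (x z : Site 2) : swap (swap η x z) x z = η := by
  funext w
  unfold swap
  by_cases h1 : w = x <;> by_cases h2 : w = z <;> by_cases h3 : z = x <;> simp_all

/-- Apply a list of exchanges. -/
def applyOps : List (Site 2 × Site 2) → Config 2 → Config 2
  | [], η => η
  | p :: l, η => applyOps l (swap η p.1 p.2)

theorem applyOps_append (l l' : List (Site 2 × Site 2)) (η : Config 2) :
    applyOps (l ++ l') η = applyOps l' (applyOps l η) := by
  induction l generalizing η with
  | nil => rfl
  | cons p l ih => simp [applyOps, ih]

theorem applyOps_reverse (l : List (Site 2 × Site 2)) (η : Config 2) :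
    applyOps l.reverse (applyOps l η) = η := by
  induction l generalizing η with
  | nil => rfl
  | cons p l ih => simp [applyOps, applyOps_append, ih, swap_swap]

/-- Every exchange of the list `l` moves (the possible particle at) `x` to an empty site,
and is allowed. -/
def Legal (V : Set (Site 2)) : List (Site 2 × Site 2) → Config 2 → Prop
  | [], _ => True
  | p :: l, η => (adj p.1 p.2 ∧ p.1 ∈ V ∧ p.2 ∈ V ∧ η p.2 = false ∧ constraint 2 η p.1 p.2) ∧
      Legal V l (swap η p.1 p.2)

theorem legal_append {V : Set (Site 2)} {l l' : List (Site 2 × Site 2)} {η : Config 2}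
    (h : Legal V l η) (h' : Legal V l' (applyOps l η)) : Legal V (l ++ l') η := by
  induction l generalizing η with
  | nil => exact h'
  | cons p l ih => exact ⟨h.1, ih h.2 h'⟩

theorem legal_get {V : Set (Site 2)} {l : List (Site 2 × Site 2)} {η : Config 2}
    (h : Legal V l η) (t : ℕ) (p : Site 2 × Site 2) (hp : l[t]? = some p) :
    adj p.1 p.2 ∧ p.1 ∈ V ∧ p.2 ∈ V ∧ applyOps (l.take t) η p.2 = false ∧
      constraint 2 (applyOps (l.take t) η) p.1 p.2 := by
  induction l generalizing η t with
  | nil => simp at hp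
  | cons q l ih =>
    cases t with
    | zero =>
      simp at hp
      subst hp
      exact h.1
    | succ t => exact ih h.2 t (by simpa using hp)

/-- The recursive sweep: row `b` is empty, and the rows `b + s, …, b + n s` get exchanged. -/
def sweep (Y s : ℤ) : ℕ → ℤ → List (Site 2 × Site 2)
  | 0, _ => []
  | n + 1, b => (mk2 (Y + 1) (b + s), mk2 Y (b + s)) :: (mk2 Y (b + s), mk2 Y b) ::
      (sweep Y s n (b + s) ++ [(mk2 Y b, mk2 Y (b + s))])

theorem sweep_length (Y s : ℤ) (n : ℕ) (b : ℤ) : (sweep Y s n b).length = 3 * n := by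
  induction n generalizing b with
  | zero => rfl
  | succ n ih => simp [sweep, ih]; ring

/-- The result of the sweep. -/
def exch (Y s : ℤ) (n : ℕ) (b : ℤ) (η : Config 2) : Config 2 := fun z =>
  if 1 ≤ s * (z 1 - b) ∧ s * (z 1 - b) ≤ n then
    (if z 0 = Y then η (mk2 (Y + 1) (z 1)) else if z 0 = Y + 1 then false else η z)
  else η z

theorem swap_left (η : Config 2) (x z : Site 2) : swap η x z x = η z := by simp [swap]

theorem swap_right (η : Config 2) (x z : Site 2) : swap η x z z = η x := by
  by_cases h : z = x
  · simp [swap, h]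
  · simp [swap, h]

theorem swap_ne (η : Config 2) (x z w : Site 2) (h1 : w ≠ x) (h2 : w ≠ z) :
    swap η x z w = η w := by simp [swap, h1, h2]

theorem mk2_ne_fst {a b c e : ℤ} (h : a ≠ c) : mk2 a b ≠ mk2 c e := by
  intro h'; exact h (by simpa using congrFun h' 0)

theorem mk2_ne_snd {a b c e : ℤ} (h : b ≠ e) : mk2 a b ≠ mk2 c e := by
  intro h'; exact h (by simpa using congrFun h' 1)

theorem adj_horiz (a b : ℤ) : adj (mk2 a b) (mk2 (a + 1) b) := by
  rw [adj_iff]; simp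

theorem adj_vert (a b s : ℤ) (hs : s = 1 ∨ s = -1) : adj (mk2 a b) (mk2 a (b + s)) := by
  rw [adj_iff]; rcases hs with rfl | rfl <;> simp

theorem sweep_spec (V : Set (Site 2)) (Y s : ℤ) (hs : s = 1 ∨ s = -1) (n : ℕ) (b : ℤ)
    (η : Config 2)
    (hV : ∀ i : ℕ, i ≤ n → mk2 Y (b + s * i) ∈ V ∧ mk2 (Y + 1) (b + s * i) ∈ V)
    (h0 : ∀ i : ℕ, i ≤ n → η (mk2 Y (b + s * i)) = false)
    (h1 : η (mk2 (Y + 1) b) = false) :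
    Legal V (sweep Y s n b) η ∧ applyOps (sweep Y s n b) η = exch Y s n b η := by
  induction n generalizing b η with
  | zero =>
    refine ⟨trivial, ?_⟩
    funext z
    simp only [sweep, applyOps, exch]
    rw [if_neg]
    push_cast
    omega
  | succ n ih =>
    have hs0 : s ≠ 0 := by rcases hs with rfl | rfl <;> norm_num
    have hbs : b + s ≠ b := by omega
    have V0 := hV 0 (by omega)
    have V1 := hV 1 (by omega)
    have e0 := h0 0 (by omega)
    have e1 := h0 1 (by omega)
    simp only [Nat.cast_zero, Nat.cast_one, mul_zero, mul_one, add_zero] at V0 V1 e0 e1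
    -- abbreviations
    set A := mk2 Y b with hA
    set B := mk2 (Y + 1) b with hB
    set A' := mk2 Y (b + s) with hA'
    set B' := mk2 (Y + 1) (b + s) with hB'
    have nAB : A ≠ B := mk2_ne_fst (by omega)
    have nA'B' : A' ≠ B' := mk2_ne_fst (by omega)
    have nAA' : A ≠ A' := mk2_ne_snd (by omega)
    have nBB' : B ≠ B' := mk2_ne_snd (by omega)
    have nAB' : A ≠ B' := mk2_ne_fst (by omega)
    have nBA' : B ≠ A' := mk2_ne_fst (by omega)
    have aAB : adj A B := adj_horiz _ _
    have aA'B' : adj A' B' := adj_horiz _ _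
    have aAA' : adj A A' := adj_vert _ _ _ hs
    have aBB' : adj B B' := adj_vert _ _ _ hs
    set η1 := swap η B' A' with hη1
    have η1A : η1 A = false := by rw [hη1, swap_ne _ _ _ _ nAB' nAA']; exact e0
    have η1B : η1 B = false := by rw [hη1, swap_ne _ _ _ _ nBB' nBA']; exact h1
    have η1A' : η1 A' = η B' := swap_right _ _ _
    have η1B' : η1 B' = false := by rw [hη1, swap_left]; exact e1
    set η2 := swap η1 A' A with hη2
    have η2A : η2 A = η B' := by rw [hη2, swap_right]; exact η1A'
    have η2B : η2 B = false := by rw [hη2, swap_ne _ _ _ _ nBA' nAB.symm]; exact η1B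
    have η2A' : η2 A' = false := by rw [hη2, swap_left]; exact η1A
    have η2B' : η2 B' = false := by
      rw [hη2, swap_ne _ _ _ _ nA'B'.symm nAB'.symm]; exact η1B'
    have η2o : ∀ w, w ≠ A → w ≠ A' → w ≠ B' → η2 w = η w := by
      intro w w1 w2 w3
      rw [hη2, swap_ne _ _ _ _ w2 w1, hη1, swap_ne _ _ _ _ w3 w2]
    have shift_row : ∀ i : ℕ, b + s + s * i = b + s * ((i + 1 : ℕ) : ℤ) := by
      intro i; push_cast; ring
    obtain ⟨hL, hR⟩ := ih (b + s) η2
      (by intro i hi; rw [shift_row]; exact hV (i + 1) (by omega))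
      (by
        intro i hi
        rcases Nat.eq_zero_or_pos i with rfl | hi0
        · simpa using η2A'
        · rw [shift_row]
          have hne : s * ((i + 1 : ℕ) : ℤ) ≠ 0 ∧ s * ((i + 1 : ℕ) : ℤ) ≠ s := by
            rcases hs with rfl | rfl <;> constructor <;> push_cast <;> omega
          rw [η2o]
          · exact h0 (i + 1) (by omega)
          · exact mk2_ne_snd (by omega)
          · exact mk2_ne_snd (by omega)
          · exact mk2_ne_fst (by omega))
      η2B'
    set η3 := exch Y s n (b + s) η2 with hη3
    have η3o : ∀ c, η3 (mk2 c b) = η2 (mk2 c b) ∧ η3 (mk2 c (b + s)) = η2 (mk2 c (b + s)) := by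
      intro c
      constructor
      · rw [hη3]; unfold exch; rw [if_neg]
        simp only [mk2_one]
        rcases hs with rfl | rfl <;> omega
      · rw [hη3]; unfold exch; rw [if_neg]
        simp only [mk2_one]
        rcases hs with rfl | rfl <;> omega
    have η3A : η3 A = η B' := (η3o Y).1.trans η2A
    have η3B : η3 B = false := (η3o (Y + 1)).1.trans η2B
    have η3A' : η3 A' = false := (η3o Y).2.trans η2A'
    have η3B' : η3 B' = false := (η3o (Y + 1)).2.trans η2B'
    constructor
    · refine ⟨⟨adj_symm' aA'B', V1.2, V1.1, e1, ?_⟩, ⟨adj_symm' aAA', V1.1, V0.1, η1A, ?_⟩,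
        legal_append hL ?_⟩
      · exact constraint_of B A (adj_symm' aBB') nBA' h1 (adj_symm' aAA') nAB' e0
      · exact constraint_of B' B aA'B' nAB'.symm η1B' aAB nBA' η1B
      · show Legal V _ (applyOps (sweep Y s n (b + s)) η2)
        rw [hR]
        refine ⟨⟨aAA', V0.1, V1.1, η3A', ?_⟩, trivial⟩
        exact constraint_of B B' aAB nBA' η3B aA'B' nAB'.symm η3B'
    · show applyOps (sweep Y s n (b + s) ++ [(A, A')]) η2 = _
      rw [applyOps_append, hR]
      show swap η3 A A' = _
      funext z
      by_cases zA : z = A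
      · rw [zA, swap_left, η3A']
        unfold exch
        rw [if_neg (by simp [hA])]
        exact e0.symm
      by_cases zA' : z = A'
      · rw [zA', swap_right, η3A]
        unfold exch
        rw [if_pos, if_pos]
        · rfl
        · rfl
        · rw [hA', mk2_one]
          rcases hs with rfl | rfl <;> push_cast <;> constructor <;> omega
      rw [swap_ne _ _ _ _ zA zA']
      by_cases zB' : z = B'
      · rw [zB', η3B']
        unfold exch
        rw [if_pos, if_neg, if_pos]
        · rfl
        · simp [hB']
        · rw [hB', mk2_one]
          rcases hs with rfl | rfl <;> push_cast <;> constructor <;> omega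
      have hz := η2o z zA zA' zB'
      rw [hη3]
      unfold exch
      have zA2 : ¬ (z 0 = Y ∧ z 1 = b + s) := fun h => zA' ((site_eq_iff _ _).2 h)
      have zB2 : ¬ (z 0 = Y + 1 ∧ z 1 = b + s) := fun h => zB' ((site_eq_iff _ _).2 h)
      by_cases c1 : 1 ≤ s * (z 1 - (b + s)) ∧ s * (z 1 - (b + s)) ≤ n
      · have c1' : 1 ≤ s * (z 1 - b) ∧ s * (z 1 - b) ≤ ((n + 1 : ℕ) : ℤ) := by
          rcases hs with rfl | rfl <;> push_cast <;> omega
        rw [if_pos c1, if_pos c1']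
        have hne : z 1 ≠ b + s := by rcases hs with rfl | rfl <;> omega
        rw [η2o (mk2 (Y + 1) (z 1)) (mk2_ne_fst (by omega)) (mk2_ne_fst (by omega))
          (mk2_ne_snd hne), hz]
      · rw [if_neg c1, hz]
        split_ifs with c2 c3 c4
        · exfalso
          have : z 1 = b + s := by rcases hs with rfl | rfl <;> push_cast at c2 <;> omega
          exact zA2 ⟨c3, this⟩
        · exfalso
          have : z 1 = b + s := by rcases hs with rfl | rfl <;> push_cast at c2 <;> omega
          exact zB2 ⟨c4, this⟩
        · rfl
        · rfl

/-- The list of exchanges for a hole at height `h`. -/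
def colOps (y : Site 2) (ℓ h : ℕ) : List (Site 2 × Site 2) :=
  sweep (y 0) 1 (ℓ - h) (y 1 + h) ++ sweep (y 0) (-1) (h - 1) (y 1 + h)

theorem colOps_length (y : Site 2) (ℓ h : ℕ) (h1 : 1 ≤ h) (h2 : h ≤ ℓ) :
    (colOps y ℓ h).length ≤ 3 * ℓ := by
  simp [colOps, sweep_length]; omega

theorem colOps_spec (y : Site 2) (ℓ h : ℕ) (hh1 : 1 ≤ h) (hh2 : h ≤ ℓ) (η : Config 2)
    (h0 : ∀ x ∈ col2 y 0 ℓ, η x = false) (h1 : η (mk2 (y 0 + 1) (y 1 + h)) = false) :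
    Legal (col2 y 0 ℓ ∪ col2 y 1 ℓ) (colOps y ℓ h) η ∧
    (∀ z ∉ col2 y 0 ℓ ∪ col2 y 1 ℓ, applyOps (colOps y ℓ h) η z = η z) ∧
    (∀ x ∈ col2 y 0 ℓ, applyOps (colOps y ℓ h) η x = η (x + eVec 2 0)) ∧
    (∀ x ∈ col2 y 1 ℓ, applyOps (colOps y ℓ h) η x = η (x - eVec 2 0)) := by
  have mem0 : ∀ r : ℤ, y 1 + 1 ≤ r → r ≤ y 1 + ℓ → mk2 (y 0) r ∈ col2 y 0 ℓ := by
    intro r hr1 hr2; exact ⟨by simp, hr1, hr2⟩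
  have mem1 : ∀ r : ℤ, y 1 + 1 ≤ r → r ≤ y 1 + ℓ → mk2 (y 0 + 1) r ∈ col2 y 1 ℓ := by
    intro r hr1 hr2; exact ⟨by simp, hr1, hr2⟩
  obtain ⟨L1, R1⟩ := sweep_spec (col2 y 0 ℓ ∪ col2 y 1 ℓ) (y 0) 1 (Or.inl rfl) (ℓ - h) (y 1 + h) η
    (fun i hi => ⟨Or.inl (mem0 _ (by omega) (by omega)), Or.inr (mem1 _ (by omega) (by omega))⟩)
    (fun i hi => h0 _ (mem0 _ (by omega) (by omega))) h1
  set η1 := exch (y 0) 1 (ℓ - h) (y 1 + h) η with hη1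
  have η1o : ∀ z : Site 2, z 1 ≤ y 1 + h → η1 z = η z := by
    intro z hz
    rw [hη1]; unfold exch
    rw [if_neg (by omega)]
  obtain ⟨L2, R2⟩ := sweep_spec (col2 y 0 ℓ ∪ col2 y 1 ℓ) (y 0) (-1) (Or.inr rfl) (h - 1)
    (y 1 + h) η1
    (fun i hi => ⟨Or.inl (mem0 _ (by omega) (by omega)), Or.inr (mem1 _ (by omega) (by omega))⟩)
    (fun i hi => by
      rw [η1o _ (by simp)]
      exact h0 _ (mem0 _ (by omega) (by omega)))
    (by rw [η1o _ (by simp)]; exact h1)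
  have R : ∀ z, applyOps (colOps y ℓ h) η z = exch (y 0) (-1) (h - 1) (y 1 + h) η1 z := by
    intro z; rw [colOps, applyOps_append, R1, R2]
  refine ⟨legal_append L1 (by rw [R1]; exact L2), ?_, ?_, ?_⟩
  · intro z hz
    have hz0 : ¬ (z 0 = y 0 + 0 ∧ y 1 + 1 ≤ z 1 ∧ z 1 ≤ y 1 + ℓ) := fun h => hz (Or.inl h)
    have hz1 : ¬ (z 0 = y 0 + 1 ∧ y 1 + 1 ≤ z 1 ∧ z 1 ≤ y 1 + ℓ) := fun h => hz (Or.inr h)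
    rw [R]
    simp only [exch, hη1]
    split_ifs <;> first | rfl | (exfalso; omega)
  · intro x hx
    have hx' := hx
    obtain ⟨x0, x1, x2⟩ := hx'
    have hxe : x + eVec 2 0 = mk2 (y 0 + 1) (x 1) := by
      rw [site_eq_iff]; simp [eVec, x0]
    rw [R, hxe]
    rcases lt_trichotomy (x 1) (y 1 + h) with hlt | heq | hgt
    · unfold exch
      rw [if_pos (by omega), if_pos (by omega)]
      exact η1o _ (by simp; omega)
    · unfold exch
      rw [if_neg (by omega), η1o _ (by omega), heq, h1]
      exact h0 x hx
    · unfold exch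
      rw [if_neg (by omega), hη1]
      unfold exch
      rw [if_pos (by omega), if_pos (by omega)]
  · intro x hx
    obtain ⟨x0, x1, x2⟩ := hx
    have hxe : x - eVec 2 0 = mk2 (y 0) (x 1) := by
      rw [site_eq_iff]; simp [eVec, x0]
    rw [R, hxe, h0 _ (mem0 _ x1 x2)]
    rcases lt_trichotomy (x 1) (y 1 + h) with hlt | heq | hgt
    · unfold exch
      rw [if_pos (by omega), if_neg (by omega), if_pos (by omega)]
    · unfold exch
      rw [if_neg (by omega), η1o _ (by omega)]
      rw [← h1]
      congr 1
      rw [site_eq_iff]; exact ⟨x0, heq⟩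
    · unfold exch
      rw [if_neg (by omega), hη1]
      unfold exch
      rw [if_pos (by omega), if_neg (by omega), if_pos (by omega)]

/-- Tracking the marked particle along a list of exchanges. -/
def trackPos (l : List (Site 2 × Site 2)) (η : Config 2) (z : Site 2) : ℕ → Site 2
  | 0 => z
  | t + 1 => match l[t]? with
    | none => trackPos l η z t
    | some p => if applyOps (l.take t) η p.1 = true then
        (if trackPos l η z t = p.1 then p.2 else trackPos l η z t) else trackPos l η z t

theorem swap_self_of_eq {η : Config 2} {x z : Site 2} (h : η x = η z) : swap η x z = η := by
  funext w
  unfold swap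
  split_ifs with h1 h2
  · rw [h1, h]
  · rw [h2, h]
  · rfl

theorem list_step {V : Set (Site 2)} {l : List (Site 2 × Site 2)} {η : Config 2}
    (h : Legal V l η) (z : Site 2) (t : ℕ) :
    (applyOps (l.take (t + 1)) η = applyOps (l.take t) η ∧
      trackPos l η z (t + 1) = trackPos l η z t) ∨
    ∃ x y, adj x y ∧ x ∈ V ∧ y ∈ V ∧ applyOps (l.take t) η x = true ∧
      applyOps (l.take t) η y = false ∧ constraint 2 (applyOps (l.take t) η) x y ∧
      applyOps (l.take (t + 1)) η = swap (applyOps (l.take t) η) x y ∧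
      trackPos l η z (t + 1) = if trackPos l η z t = x then y else trackPos l η z t := by
  have htake : applyOps (l.take (t + 1)) η = applyOps l[t]?.toList (applyOps (l.take t) η) := by
    rw [List.take_add_one, applyOps_append]
  rcases hp : l[t]? with _ | p
  · left
    rw [htake, hp]
    refine ⟨rfl, ?_⟩
    simp [trackPos, hp]
  · obtain ⟨g1, g2, g3, g4, g5⟩ := legal_get h t p hp
    rw [htake, hp]
    by_cases hx : applyOps (l.take t) η p.1 = true
    · right
      refine ⟨p.1, p.2, g1, g2, g3, hx, g4, g5, rfl, ?_⟩
      simp [trackPos, hp, hx]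
    · left
      constructor
      · exact swap_self_of_eq (by rw [g4]; simpa using hx)
      · simp [trackPos, hp, hx]

/-- (Column exchange move, `k = d = 2`.) An empty column can be
exchanged with an adjacent column containing an empty site, with
`T ≤ C ℓ` and `Loss ≤ C log₂ ℓ`. -/
theorem statement8 :
    ∃ C : ℝ, 0 < C ∧
      ∀ ℓ : ℕ, 2 ≤ ℓ → ∀ y : Site 2,
        ∃ T : ℕ,
          ∃ mv : TStepMove 2 2
            {η | (∀ x ∈ col2 y 0 ℓ, η x = false) ∧ ∃ x ∈ col2 y 1 ℓ, η x = false}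
            (col2 y 0 ℓ ∪ col2 y 1 ℓ) T,
            (T : ℝ) ≤ C * ℓ ∧
            LossBoundedBy mv (C * Real.logb 2 ℓ) ∧
            ∀ η : Config 2,
              ((∀ x ∈ col2 y 0 ℓ, η x = false) ∧ ∃ x ∈ col2 y 1 ℓ, η x = false) →
              (∀ z ∉ col2 y 0 ℓ ∪ col2 y 1 ℓ, mv.conf η T z = η z) ∧
              (∀ x ∈ col2 y 0 ℓ, mv.conf η T x = η (x + eVec 2 0)) ∧
              (∀ x ∈ col2 y 1 ℓ, mv.conf η T x = η (x - eVec 2 0)) := by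
  refine ⟨3, by norm_num, ?_⟩
  intro ℓ hℓ y
  have hex : ∀ η : Config 2, ∃ h : ℕ,
      ((∀ x ∈ col2 y 0 ℓ, η x = false) ∧ ∃ x ∈ col2 y 1 ℓ, η x = false) →
      (1 ≤ h ∧ h ≤ ℓ ∧ η (mk2 (y 0 + 1) (y 1 + h)) = false) := by
    intro η
    by_cases hη : (∀ x ∈ col2 y 0 ℓ, η x = false) ∧ ∃ x ∈ col2 y 1 ℓ, η x = false
    · obtain ⟨_, x, ⟨x0, x1, x2⟩, hx⟩ := hη
      refine ⟨(x 1 - y 1).toNat, fun _ => ⟨by omega, by omega, ?_⟩⟩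
      rw [← hx]
      congr 1
      rw [site_eq_iff]
      simp only [mk2_zero, mk2_one]
      omega
    · exact ⟨0, fun h => absurd h hη⟩
  choose H hH using hex
  have hspec := fun (η : Config 2)
      (hη : (∀ x ∈ col2 y 0 ℓ, η x = false) ∧ ∃ x ∈ col2 y 1 ℓ, η x = false) =>
    colOps_spec y ℓ (H η) (hH η hη).1 (hH η hη).2.1 η hη.1 (hH η hη).2.2
  refine ⟨3 * ℓ,
    { conf := fun η t => applyOps ((colOps y ℓ (H η)).take t) η
      pos := fun η z t => trackPos (colOps y ℓ (H η)) η z t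
      conf_zero := fun η _ => rfl
      pos_zero := fun η _ z _ => rfl
      step := fun η hη z _ t _ => list_step (hspec η hη).1 z t }, ?_, ?_, ?_⟩
  · push_cast; exact le_refl _
  · intro t _ η' _
    refine ⟨(Finset.Icc 1 ℓ).image (fun h =>
      applyOps ((colOps y ℓ h).take t).reverse (applyOps ((colOps y ℓ (H η')).take t) η')), ?_, ?_⟩
    · rintro η ⟨hη, heq, _⟩
      have hη2 := hH η hη
      rw [Finset.mem_coe, Finset.mem_image]
      refine ⟨H η, Finset.mem_Icc.2 ⟨hη2.1, hη2.2.1⟩, ?_⟩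
      have heq' : applyOps ((colOps y ℓ (H η)).take t) η =
        applyOps ((colOps y ℓ (H η')).take t) η' := heq
      rw [← heq', applyOps_reverse]
    · have hc : ((Finset.Icc 1 ℓ).image (fun h => applyOps ((colOps y ℓ h).take t).reverse
          (applyOps ((colOps y ℓ (H η')).take t) η'))).card ≤ ℓ :=
        Finset.card_image_le.trans (by simp)
      have hℓ1 : (1 : ℝ) < ℓ := by exact_mod_cast (by omega : 1 < ℓ)
      have hlog : 0 ≤ Real.logb 2 (ℓ : ℝ) := Real.logb_nonneg (by norm_num) hℓ1.le
      calc _ ≤ (ℓ : ℝ) := by exact_mod_cast hc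
        _ = (2 : ℝ) ^ (Real.logb 2 (ℓ : ℝ)) :=
          (Real.rpow_logb (by norm_num) (by norm_num) (by linarith)).symm
        _ ≤ _ := Real.rpow_le_rpow_of_exponent_le (by norm_num) (by linarith)
  · intro η hη
    have hT : (colOps y ℓ (H η)).take (3 * ℓ) = colOps y ℓ (H η) :=
      List.take_of_length_le (colOps_length y ℓ (H η) (hH η hη).1 (hH η hη).2.1)
    have := (hspec η hη).2
    simp only [hT]
    exact this

end KA
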